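/- arXiv:1801.02854 — 4 statements merged into one kernel-verified Lean document; each statement's English description precedes it below -/
import Mathlib

section
/- Associativity of RMP combination: Let G₁, G₂, G₃ be symmetric positive semidefinite real m×m matrices and f₁, f₂, f₃ ∈ ℝᵐ. Let P₁₂ be a Moore–Penrose pseudoinverse of G₁+G₂, set f₁₂ = P₁₂ ⬝ (G₁f₁ + G₂f₂), and let P be a Moore–Penrose pseudoinverse of G₁+G₂+G₃. Then the nested combination equals the flat combination: P ⬝ ((G₁+G₂) ⬝ f₁₂ + G₃f₃) = P ⬝ (G₁f₁ + G₂f₂ + G₃f₃). -/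
open Matrix

/-- `B` is a Moore–Penrose pseudoinverse of `A`. -/
def IsMoorePenrose {m n : ℕ} (A : Matrix (Fin m) (Fin n) ℝ)
    (B : Matrix (Fin n) (Fin m) ℝ) : Prop :=
  A * B * A = A ∧ B * A * B = B ∧ (A * B)ᵀ = A * B ∧ (B * A)ᵀ = B * A

theorem rmp_aux {m : ℕ} (A B Q : Matrix (Fin m) (Fin m) ℝ)
    (hA : A.PosSemidef) (hB : B.PosSemidef) (hQ : (A + B) * Q = A + B) : A * Q = A := by
  have key : ∀ y : Fin m → ℝ, (A + B) *ᵥ y = 0 → A *ᵥ y = 0 := by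
    intro y hy
    rw [← hA.dotProduct_mulVec_zero_iff]
    have h1 := hA.dotProduct_mulVec_nonneg y
    have h2 := hB.dotProduct_mulVec_nonneg y
    have h3 : star y ⬝ᵥ ((A + B) *ᵥ y) = 0 := by rw [hy, dotProduct_zero]
    rw [add_mulVec, dotProduct_add] at h3
    linarith
  apply Matrix.ext_of_mulVec_single
  intro i
  have h := key (Q *ᵥ Pi.single i 1 - Pi.single i 1) (by
    rw [mulVec_sub, mulVec_mulVec, hQ, sub_self])
  rw [mulVec_sub, mulVec_mulVec] at h
  exact sub_eq_zero.mp h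

theorem rmp_aux2 {m : ℕ} (A B P : Matrix (Fin m) (Fin m) ℝ)
    (hA : A.PosSemidef) (hB : B.PosSemidef) (hP : IsMoorePenrose (A + B) P) :
    (A + B) * P * A = A := by
  obtain ⟨h1, -, h3, -⟩ := hP
  have tA : Aᵀ = A := by simpa using hA.isHermitian.eq
  have tB : Bᵀ = B := by simpa using hB.isHermitian.eq
  have h : A * ((A + B) * P) = A := by
    apply rmp_aux A B _ hA hB
    have := congrArg transpose h1
    rwa [transpose_mul, h3, transpose_add, tA, tB] at this
  have := congrArg transpose h
  rwa [transpose_mul, h3, tA] at this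

/-- Associativity of RMP combination. -/
theorem rmp_combination_assoc (m : ℕ)
    (G₁ G₂ G₃ : Matrix (Fin m) (Fin m) ℝ)
    (hG₁ : G₁.PosSemidef) (hG₂ : G₂.PosSemidef) (hG₃ : G₃.PosSemidef)
    (f₁ f₂ f₃ : Fin m → ℝ)
    (P₁₂ : Matrix (Fin m) (Fin m) ℝ)
    (hP₁₂ : IsMoorePenrose (G₁ + G₂) P₁₂)
    (f₁₂ : Fin m → ℝ)
    (hf₁₂ : f₁₂ = P₁₂ *ᵥ (G₁ *ᵥ f₁ + G₂ *ᵥ f₂))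
    (P : Matrix (Fin m) (Fin m) ℝ)
    (hP : IsMoorePenrose (G₁ + G₂ + G₃) P) :
    P *ᵥ ((G₁ + G₂) *ᵥ f₁₂ + G₃ *ᵥ f₃) =
      P *ᵥ (G₁ *ᵥ f₁ + G₂ *ᵥ f₂ + G₃ *ᵥ f₃) := by
  have e1 := rmp_aux2 G₁ G₂ P₁₂ hG₁ hG₂ hP₁₂
  have e2 := rmp_aux2 G₂ G₁ P₁₂ hG₂ hG₁ (by rwa [add_comm])
  rw [add_comm G₂ G₁] at e2
  have e : (G₁ + G₂) *ᵥ f₁₂ = G₁ *ᵥ f₁ + G₂ *ᵥ f₂ := by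
    rw [hf₁₂, mulVec_mulVec, mulVec_add, mulVec_mulVec, mulVec_mulVec, e1, e2]
  rw [e]
end

section
/- Linearity of the RMP pullback: Let G₁, G₂ be symmetric positive semidefinite real m×m matrices, f₁, f₂ ∈ ℝᵐ, and J an m×n real matrix. Let P_c be a Moore–Penrose pseudoinverse of G₁+G₂ and set f_c = P_c ⬝ (G₁f₁ + G₂f₂). Let Bᵢ be a Moore–Penrose pseudoinverse of JᵀGᵢJ, set pᵢ = Bᵢ ⬝ JᵀGᵢfᵢ for i = 1,2, and let Q be a Moore–Penrose pseudoinverse of Jᵀ(G₁+G₂)J. Then the pullback of the combination equals the combination of the pullbacks: Q ⬝ Jᵀ(G₁+G₂)f_c = Q ⬝ (JᵀG₁J ⬝ p₁ + JᵀG₂J ⬝ p₂), and both sides equal Q ⬝ (JᵀG₁f₁ + JᵀG₂f₂). -/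
open Matrix

theorem mp_ker {m : ℕ} {A : Matrix (Fin m) (Fin m) ℝ} {B : Matrix (Fin m) (Fin m) ℝ}
    (hA : Aᵀ = A) (h : IsMoorePenrose A B) : A * (1 - A * B) = 0 := by
  obtain ⟨h1, -, h3, -⟩ := h
  have : (1 - A * B) * A = 0 := by rw [sub_mul, one_mul, h1, sub_self]
  have h' := congrArg transpose this
  rwa [transpose_mul, transpose_sub, h3, transpose_one, hA, transpose_zero] at h'

theorem psd_transpose {m : ℕ} {G : Matrix (Fin m) (Fin m) ℝ} (hG : G.PosSemidef) : Gᵀ = G := by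
  have := hG.isHermitian.eq
  rwa [conjTranspose_eq_transpose_of_trivial] at this

theorem psd_ker {m n : ℕ} {G : Matrix (Fin m) (Fin m) ℝ} (hG : G.PosSemidef)
    (K : Matrix (Fin m) (Fin n) ℝ) (h : ∀ x, (K *ᵥ x) ⬝ᵥ (G *ᵥ (K *ᵥ x)) = 0) :
    Kᵀ * G = 0 := by
  have h0 : G * K = 0 := by
    apply Matrix.ext_of_mulVec_single
    intro i
    rw [← mulVec_mulVec, zero_mulVec]
    exact (hG.dotProduct_mulVec_zero_iff (K *ᵥ Pi.single i 1)).1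
      (by rw [star_trivial]; exact h _)
  have h' := congrArg transpose h0
  rwa [transpose_mul, psd_transpose hG, transpose_zero] at h'

theorem pull_id {m n : ℕ} {G : Matrix (Fin m) (Fin m) ℝ} (hG : G.PosSemidef)
    {J : Matrix (Fin m) (Fin n) ℝ} {B : Matrix (Fin n) (Fin n) ℝ}
    (h : IsMoorePenrose (Jᵀ * G * J) B) : (Jᵀ * G * J) * B * (Jᵀ * G) = Jᵀ * G := by
  have hs : (Jᵀ * G * J)ᵀ = Jᵀ * G * J := by
    simp [transpose_mul, psd_transpose hG, Matrix.mul_assoc]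
  have hk := mp_ker hs h
  have := psd_ker hG (J * (1 - Jᵀ * G * J * B)) (fun x => by
    have e : Jᵀ *ᵥ (G *ᵥ ((J * (1 - Jᵀ * G * J * B)) *ᵥ x)) = 0 := by
      rw [mulVec_mulVec, mulVec_mulVec, ← Matrix.mul_assoc, hk, zero_mulVec]
    rw [← mulVec_mulVec] at e ⊢
    rw [dotProduct_comm, dotProduct_mulVec, ← mulVec_transpose, e, zero_dotProduct])
  rw [transpose_mul, transpose_sub, transpose_one, h.2.2.1, Matrix.mul_assoc, Matrix.sub_mul,
    Matrix.one_mul, sub_eq_zero] at this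
  exact this.symm

theorem comb_id {m : ℕ} {G H : Matrix (Fin m) (Fin m) ℝ} (hG : G.PosSemidef)
    (hH : H.PosSemidef) {P : Matrix (Fin m) (Fin m) ℝ}
    (h : IsMoorePenrose (G + H) P) : (G + H) * P * G = G := by
  have hk := mp_ker (psd_transpose (hG.add hH)) h
  have := psd_ker hG (1 - (G + H) * P) (fun x => by
    have e : (G + H) *ᵥ ((1 - (G + H) * P) *ᵥ x) = 0 := by
      rw [mulVec_mulVec, hk, zero_mulVec]
    generalize (1 - (G + H) * P) *ᵥ x = y at e
    have e2 : y ⬝ᵥ (G *ᵥ y) + y ⬝ᵥ (H *ᵥ y) = 0 := by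
      rw [← dotProduct_add, ← add_mulVec, e, dotProduct_zero]
    have a := hG.dotProduct_mulVec_nonneg y
    have b := hH.dotProduct_mulVec_nonneg y
    simp only [star_trivial] at a b
    linarith)
  rw [transpose_sub, transpose_one, h.2.2.1, sub_mul, one_mul, sub_eq_zero] at this
  exact this.symm

/-- Linearity of the RMP pullback: the pullback of a combination equals the
combination of the pullbacks. -/
theorem rmp_pullback_linear (m n : ℕ)
    (G₁ G₂ : Matrix (Fin m) (Fin m) ℝ)
    (hG₁ : G₁.PosSemidef) (hG₂ : G₂.PosSemidef)
    (f₁ f₂ : Fin m → ℝ)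
    (J : Matrix (Fin m) (Fin n) ℝ)
    (Pc : Matrix (Fin m) (Fin m) ℝ)
    (hPc : IsMoorePenrose (G₁ + G₂) Pc)
    (fc : Fin m → ℝ)
    (hfc : fc = Pc *ᵥ (G₁ *ᵥ f₁ + G₂ *ᵥ f₂))
    (B₁ B₂ : Matrix (Fin n) (Fin n) ℝ)
    (hB₁ : IsMoorePenrose (Jᵀ * G₁ * J) B₁)
    (hB₂ : IsMoorePenrose (Jᵀ * G₂ * J) B₂)
    (p₁ p₂ : Fin n → ℝ)
    (hp₁ : p₁ = B₁ *ᵥ (Jᵀ *ᵥ (G₁ *ᵥ f₁)))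
    (hp₂ : p₂ = B₂ *ᵥ (Jᵀ *ᵥ (G₂ *ᵥ f₂)))
    (Q : Matrix (Fin n) (Fin n) ℝ)
    (hQ : IsMoorePenrose (Jᵀ * (G₁ + G₂) * J) Q) :
    Q *ᵥ (Jᵀ *ᵥ ((G₁ + G₂) *ᵥ fc)) =
        Q *ᵥ ((Jᵀ * G₁ * J) *ᵥ p₁ + (Jᵀ * G₂ * J) *ᵥ p₂) ∧
      Q *ᵥ (Jᵀ *ᵥ ((G₁ + G₂) *ᵥ fc)) =
        Q *ᵥ (Jᵀ *ᵥ (G₁ *ᵥ f₁) + Jᵀ *ᵥ (G₂ *ᵥ f₂)) := by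
  have c1 := comb_id hG₁ hG₂ hPc
  have c2 := comb_id hG₂ hG₁ (P := Pc) (by rwa [add_comm])
  rw [add_comm G₂ G₁] at c2
  have q1 := pull_id hG₁ hB₁
  have q2 := pull_id hG₂ hB₂
  have e0 : (G₁ + G₂) *ᵥ fc = G₁ *ᵥ f₁ + G₂ *ᵥ f₂ := by
    rw [hfc, mulVec_mulVec, mulVec_add, mulVec_mulVec, mulVec_mulVec, c1, c2]
  have e1 : (Jᵀ * G₁ * J) *ᵥ p₁ = Jᵀ *ᵥ (G₁ *ᵥ f₁) := by
    rw [hp₁, mulVec_mulVec _ Jᵀ, mulVec_mulVec, mulVec_mulVec, q1]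
  have e2 : (Jᵀ * G₂ * J) *ᵥ p₂ = Jᵀ *ᵥ (G₂ *ᵥ f₂) := by
    rw [hp₂, mulVec_mulVec _ Jᵀ, mulVec_mulVec, mulVec_mulVec, q2]
  rw [e0, e1, e2, mulVec_add]
  exact ⟨rfl, rfl⟩
end

section
/- Composition of pullbacks equals pullback through the composed map: Let G be a symmetric positive semidefinite real m×m matrix, f ∈ ℝᵐ, J_φ an m×n real matrix, and J_ψ an n×k real matrix. Let B be a Moore–Penrose pseudoinverse of J_φᵀ G J_φ, set b = B ⬝ J_φᵀ G f, and let Q be a Moore–Penrose pseudoinverse of J_ψᵀ (J_φᵀ G J_φ) J_ψ. Then the resolution of the pullback through J_ψ of the pullback through J_φ equals the resolution of the pullback through J_φ J_ψ: Q ⬝ J_ψᵀ (J_φᵀ G J_φ) b = Q ⬝ (J_φ J_ψ)ᵀ G f. -/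
open Matrix

/-- Composition of pullbacks equals pullback through the composed map. -/
theorem rmp_pullback_comp (m n k : ℕ)
    (G : Matrix (Fin m) (Fin m) ℝ) (hG : G.PosSemidef)
    (f : Fin m → ℝ)
    (Jφ : Matrix (Fin m) (Fin n) ℝ)
    (Jψ : Matrix (Fin n) (Fin k) ℝ)
    (B : Matrix (Fin n) (Fin n) ℝ)
    (hB : IsMoorePenrose (Jφᵀ * G * Jφ) B)
    (b : Fin n → ℝ)
    (hb : b = B *ᵥ (Jφᵀ *ᵥ (G *ᵥ f)))
    (Q : Matrix (Fin k) (Fin k) ℝ)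
    (hQ : IsMoorePenrose (Jψᵀ * (Jφᵀ * G * Jφ) * Jψ) Q) :
    Q *ᵥ (Jψᵀ *ᵥ ((Jφᵀ * G * Jφ) *ᵥ b)) = Q *ᵥ ((Jφ * Jψ)ᵀ *ᵥ (G *ᵥ f)) := by
  obtain ⟨h1, -, h3, -⟩ := hB
  have hGt : Gᵀ = G := by
    have := hG.1
    rwa [Matrix.IsHermitian, Matrix.conjTranspose_eq_transpose_of_trivial] at this
  have hAt : (Jφᵀ * G * Jφ)ᵀ = Jφᵀ * G * Jφ := by
    simp [Matrix.transpose_mul, hGt, Matrix.mul_assoc]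
  have hAAB : (Jφᵀ * G * Jφ) * ((Jφᵀ * G * Jφ) * B) = Jφᵀ * G * Jφ := by
    have h := congrArg Matrix.transpose h1
    rwa [Matrix.transpose_mul, h3, hAt] at h
  have key : G * Jφ * ((Jφᵀ * G * Jφ) * B) = G * Jφ := by
    apply Matrix.ext_of_mulVec_single
    intro i
    set x : Fin n → ℝ := Pi.single i 1
    set y : Fin n → ℝ := ((Jφᵀ * G * Jφ) * B) *ᵥ x - x with hy
    have hAy : (Jφᵀ * G * Jφ) *ᵥ y = 0 := by
      rw [hy, Matrix.mulVec_sub, Matrix.mulVec_mulVec, hAAB, sub_self]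
    have hq : star (Jφ *ᵥ y) ⬝ᵥ G *ᵥ (Jφ *ᵥ y) = 0 := by
      have h : y ⬝ᵥ (Jφᵀ * G * Jφ) *ᵥ y = 0 := by rw [hAy, dotProduct_zero]
      rw [star_trivial, ← h, Matrix.mul_assoc, ← Matrix.mulVec_mulVec,
        Matrix.dotProduct_mulVec y, Matrix.vecMul_transpose, ← Matrix.mulVec_mulVec]
    have h0 := (hG.dotProduct_mulVec_zero_iff _).1 hq
    rw [Matrix.mulVec_mulVec, hy, Matrix.mulVec_sub, Matrix.mulVec_mulVec, sub_eq_zero] at h0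
    exact h0
  have key2 : (Jφᵀ * G * Jφ) * B * (Jφᵀ * G) = Jφᵀ * G := by
    have h := congrArg Matrix.transpose key
    rwa [Matrix.transpose_mul, h3, Matrix.transpose_mul, hGt] at h
  have e : (Jφᵀ * G * Jφ) *ᵥ b = (Jφᵀ * G) *ᵥ f := by
    rw [hb, Matrix.mulVec_mulVec, Matrix.mulVec_mulVec, Matrix.mulVec_mulVec, Matrix.mul_assoc _ Jφᵀ G, key2]
  rw [e, Matrix.transpose_mul, ← Matrix.mulVec_mulVec, ← Matrix.mulVec_mulVec]
end

section
/- Forces from combined task-space RMPs lie in the range of the combined pullback metric: For i = 1,…,N let Aᵢ be a symmetric positive semidefinite real mᵢ×mᵢ matrix, Jᵢ an mᵢ×n real matrix, and xᵢ ∈ ℝ^{mᵢ}. Then the vector Σᵢ JᵢᵀAᵢxᵢ lies in the range of the matrix Σᵢ JᵢᵀAᵢJᵢ. -/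
open Matrix

/-- Forces from combined task-space RMPs lie in the range of the combined
pullback metric: `∑ᵢ JᵢᵀAᵢxᵢ ∈ range (∑ᵢ JᵢᵀAᵢJᵢ)`. -/
theorem force_mem_range_combined_metric (N n : ℕ) (m : Fin N → ℕ)
    (A : ∀ i, Matrix (Fin (m i)) (Fin (m i)) ℝ)
    (J : ∀ i, Matrix (Fin (m i)) (Fin n) ℝ)
    (x : ∀ i, Fin (m i) → ℝ)
    (hA : ∀ i, (A i).PosSemidef) :
    (∑ i, (J i)ᵀ *ᵥ (A i *ᵥ x i)) ∈
      Set.range (∑ i, (J i)ᵀ * A i * J i).mulVec := by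
  set M := ∑ i, (J i)ᵀ * A i * J i with hM
  set f := ∑ i, (J i)ᵀ *ᵥ (A i *ᵥ x i) with hf
  suffices h : f ∈ LinearMap.range M.mulVecLin by
    obtain ⟨w, hw⟩ := h
    exact ⟨w, hw⟩
  by_contra hn
  obtain ⟨φ, hφ, hφ0⟩ := Submodule.exists_le_ker_of_notMem hn
  obtain ⟨v, rfl⟩ := (dotProductEquiv ℝ (Fin n)).surjective φ
  have key : ∀ i (y : Fin (m i) → ℝ),
      v ⬝ᵥ ((J i)ᵀ *ᵥ (A i *ᵥ y)) = (J i *ᵥ v) ⬝ᵥ (A i *ᵥ y) := by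
    intro i y
    rw [dotProduct_mulVec, vecMul_transpose]
  have h0 : v ⬝ᵥ (M *ᵥ v) = 0 := hφ0 ⟨v, rfl⟩
  have h1 : ∑ i, (J i *ᵥ v) ⬝ᵥ (A i *ᵥ (J i *ᵥ v)) = 0 := by
    rw [← h0, hM, Matrix.sum_mulVec, dotProduct_sum]
    refine Finset.sum_congr rfl fun i _ => ?_
    rw [← key, mulVec_mulVec, mulVec_mulVec, Matrix.mul_assoc]
  have h2 := (Finset.sum_eq_zero_iff_of_nonneg
    (fun i _ => by simpa using (hA i).dotProduct_mulVec_nonneg (J i *ᵥ v))).1 h1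
  apply hφ
  change v ⬝ᵥ f = 0
  rw [hf, dotProduct_sum]
  refine Finset.sum_eq_zero fun i hi => ?_
  have h3 : A i *ᵥ (J i *ᵥ v) = 0 :=
    ((hA i).dotProduct_mulVec_zero_iff _).1 (by simpa using h2 i hi)
  have hs : (A i)ᵀ = A i := by simpa using (hA i).isHermitian.eq
  rw [key, dotProduct_mulVec, ← mulVec_transpose, hs, h3, zero_dotProduct]
end
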